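/- arXiv:2110.04515 — 2 statements merged into one kernel-verified Lean document; each statement's English description precedes it below -/
import Mathlib

section
/- For any bounded measurable set F ⊆ ℝ^p and any 0 < α ≤ 1, the quantity D_*(α, F) satisfies D_*(α, F) ≤ max{0, (upper box dimension of F) − 1}. -/
open Set Metric MeasureTheory Filter

noncomputable section

abbrev Euc (p : ℕ) := EuclideanSpace ℝ (Fin p)

/-- The closed dyadic grid cube of side `2^{-N}` indexed by `k`. -/
def gridCube (p : ℕ) (N : ℕ) (k : Fin p → ℤ) : Set (Euc p) :=
  {x | ∀ i, (k i : ℝ) * (2 : ℝ) ^ (-(N : ℤ)) ≤ x i ∧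
        x i ≤ ((k i : ℝ) + 1) * (2 : ℝ) ^ (-(N : ℤ))}

/-- The number of closed `2^{-N}` grid cubes intersected by `F`. -/
def cubeCount (p : ℕ) (F : Set (Euc p)) (N : ℕ) : ℕ :=
  Set.ncard {k : Fin p → ℤ | (gridCube p N k ∩ F).Nonempty}

/-- The upper box (Minkowski) dimension, via dyadic cube counting. -/
def upperBoxDim (p : ℕ) (F : Set (Euc p)) : ℝ :=
  Filter.limsup (fun N : ℕ => Real.logb 2 (cubeCount p F N) / N) Filter.atTop

/-- The space `C₁^α(F)` of 1-Hölder-α functions on `F`, with the supremum metric. -/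
def HolderBall (p : ℕ) (α : ℝ) (F : Set (Euc p)) :=
  {f : BoundedContinuousFunction ↥F ℝ // ∀ x y : ↥F, |f x - f y| ≤ dist x y ^ α}

instance (p : ℕ) (α : ℝ) (F : Set (Euc p)) : MetricSpace (HolderBall p α F) :=
  inferInstanceAs (MetricSpace
    {f : BoundedContinuousFunction ↥F ℝ // ∀ x y : ↥F, |f x - f y| ≤ dist x y ^ α})

/-- `D_*^f(A) = sup{d : λ{r : dim_H (f⁻¹(r) ∩ A) ≥ d} > 0}`. -/
def DstarOn {p : ℕ} {F : Set (Euc p)} (f : ↥F → ℝ) (A : Set ↥F) : ℝ :=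
  sSup {d : ℝ | 0 < volume {r : ℝ | ENNReal.ofReal d ≤ dimH (f ⁻¹' {r} ∩ A)}}

/-- `D_*(α, F)`: the sup over dense `G_δ` subsets `𝒢` of `C₁^α(F)` of
`inf{D_*^f : f ∈ 𝒢}`. -/
def DstarAlpha (p : ℕ) (α : ℝ) (F : Set (Euc p)) : ℝ :=
  sSup {v : ℝ | ∃ G : Set (HolderBall p α F), Dense G ∧ IsGδ G ∧
    v = sInf ((fun f : HolderBall p α F =>
      DstarOn (fun x : ↥F => f.1 x) Set.univ) '' G)}

/-- Truncated modulus `min (t^α) (L t)`. -/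
def omg (α L t : ℝ) : ℝ := min (t ^ α) (L * t)

lemma omg_aux {α L s t : ℝ} (h0 : 0 < α) (h1 : α ≤ 1) (hs : 0 ≤ s) (ht : 0 ≤ t)
    (hL : 0 ≤ L) (h : s ^ α ≤ L * s) : omg α L (s + t) ≤ s ^ α + L * t := by
  rcases hs.eq_or_lt with rfl | hs
  · rw [Real.zero_rpow h0.ne', zero_add, zero_add]
    exact min_le_right _ _
  · refine (min_le_left _ _).trans ?_
    have e : s + t = s * (1 + t / s) := by field_simp
    have hts : 0 ≤ t / s := by positivity
    have hb := rpow_one_add_le_one_add_mul_self (s := t / s) (by linarith) h0.le h1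
    rw [e, Real.mul_rpow hs.le (by positivity)]
    have hp : 0 ≤ s ^ α := by positivity
    calc s ^ α * (1 + t / s) ^ α ≤ s ^ α * (1 + α * (t / s)) := by gcongr
      _ ≤ s ^ α * (1 + 1 * (t / s)) := by gcongr
      _ = s ^ α + s ^ α * (t / s) := by ring
      _ ≤ s ^ α + L * s * (t / s) := by gcongr
      _ = s ^ α + L * t := by field_simp

lemma omg_add {α L s t : ℝ} (h0 : 0 < α) (h1 : α ≤ 1) (hs : 0 ≤ s) (ht : 0 ≤ t)
    (hL : 0 ≤ L) : omg α L (s + t) ≤ omg α L s + omg α L t := by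
  rcases le_total (s ^ α) (L * s) with h | h <;> rcases le_total (t ^ α) (L * t) with h' | h'
  · rw [omg, omg, omg, min_eq_left h, min_eq_left h']
    exact (min_le_left _ _).trans (Real.rpow_add_le_add_rpow hs ht h0.le h1)
  · rw [show omg α L s = s ^ α from min_eq_left h, show omg α L t = L * t from min_eq_right h']
    exact omg_aux h0 h1 hs ht hL h
  · rw [show omg α L t = t ^ α from min_eq_left h', show omg α L s = L * s from min_eq_right h,
      add_comm s t, add_comm (L * s)]
    exact omg_aux h0 h1 ht hs hL h'
  · rw [omg, omg, omg, min_eq_right h, min_eq_right h']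
    exact (min_le_right _ _).trans (by linarith)

lemma omg_mono {α L s t : ℝ} (h0 : 0 < α) (hs : 0 ≤ s) (hst : s ≤ t)
    (hL : 0 ≤ L) : omg α L s ≤ omg α L t := by
  unfold omg
  gcongr

lemma omg_nonneg {α L s : ℝ} (hs : 0 ≤ s) (hL : 0 ≤ L) : 0 ≤ omg α L s := by
  unfold omg
  positivity

lemma exists_L {α ε : ℝ} (h0 : 0 < α) (h1 : α ≤ 1) (hε : 0 < ε) :
    ∃ L : ℝ, 0 ≤ L ∧ ∀ t, 0 ≤ t → t ^ α ≤ omg α L t + ε := by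
  obtain ⟨δ, hδ, hδε⟩ : ∃ δ : ℝ, 0 < δ ∧ δ ^ α = ε :=
    ⟨ε ^ α⁻¹, by positivity, Real.rpow_inv_rpow hε.le h0.ne'⟩
  refine ⟨δ ^ (α - 1), by positivity, fun t ht => ?_⟩
  have : t ^ α ≤ δ ^ (α - 1) * t + ε := by
    rcases le_total t δ with h | h
    · have : t ^ α ≤ δ ^ α := by gcongr
      have : 0 ≤ δ ^ (α - 1) * t := by positivity
      linarith
    · have htp : 0 < t := hδ.trans_le h
      have e : t ^ α = t ^ (α - 1) * t := by
        rw [← Real.rpow_add_one htp.ne']; ring_nf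
      have := Real.rpow_le_rpow_of_nonpos hδ h (by linarith : α - 1 ≤ 0)
      rw [e]
      nlinarith
  unfold omg
  rw [← min_add_add_right]
  exact le_min (by linarith) this

lemma exists_lip {p : ℕ} {α : ℝ} {F : Set (Euc p)} (h0 : 0 < α) (h1 : α ≤ 1)
    (f : HolderBall p α F) {ε : ℝ} (hε : 0 < ε) :
    ∃ g : HolderBall p α F, ∃ L : ℝ, (∀ x y : ↥F, |g.1 x - g.1 y| ≤ L * dist x y) ∧
      dist g f ≤ ε := by
  obtain ⟨L, hL, hLt⟩ := exists_L h0 h1 hε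
  let g0 : ↥F → ℝ := fun x => ⨅ y : ↥F, (f.1 y + omg α L (dist x y))
  have hlow : ∀ x y, f.1 x - ε ≤ f.1 y + omg α L (dist x y) := fun x y => by
    have a := f.2 x y
    have b := hLt _ (dist_nonneg (x := x) (y := y))
    have c := le_abs_self (f.1 x - f.1 y)
    linarith
  have hbdd : ∀ x, BddBelow (range fun y : ↥F => (f.1 y + omg α L (dist x y))) := fun x =>
    ⟨f.1 x - ε, by rintro _ ⟨y, rfl⟩; exact hlow x y⟩
  have hge : ∀ x, f.1 x - ε ≤ g0 x := fun x => by
    have : Nonempty ↥F := ⟨x⟩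
    exact le_ciInf (hlow x)
  have hle : ∀ x, g0 x ≤ f.1 x := fun x => by
    refine (ciInf_le (hbdd x) x).trans ?_
    simp [omg, Real.zero_rpow h0.ne']
  have hclose : ∀ x, |g0 x - f.1 x| ≤ ε := fun x => by
    rw [abs_le]; constructor <;> linarith [hge x, hle x]
  have hom1 : ∀ x x', g0 x - g0 x' ≤ omg α L (dist x x') := fun x x' => by
    have : Nonempty ↥F := ⟨x⟩
    have : g0 x - omg α L (dist x x') ≤ g0 x' := by
      refine le_ciInf fun y => ?_
      have a : g0 x ≤ f.1 y + omg α L (dist x y) := ciInf_le (hbdd x) y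
      have b := omg_mono h0 dist_nonneg (dist_triangle x x' y) hL
      have c := omg_add h0 h1 (dist_nonneg (x := x) (y := x')) (dist_nonneg (x := x') (y := y)) hL
      linarith
    linarith
  have hom : ∀ x x', |g0 x - g0 x'| ≤ omg α L (dist x x') := fun x x' => by
    rw [abs_le]
    have := hom1 x' x
    rw [dist_comm] at this
    constructor <;> linarith [hom1 x x']
  have hlip : ∀ x x', |g0 x - g0 x'| ≤ L * dist x x' := fun x x' =>
    (hom x x').trans (min_le_right _ _)
  have hcont : Continuous g0 := by
    refine (LipschitzWith.of_dist_le_mul (K := ⟨L, hL⟩) fun x y => ?_).continuous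
    rw [Real.dist_eq]
    exact hlip x y
  let g1 : BoundedContinuousFunction ↥F ℝ :=
    BoundedContinuousFunction.ofNormedAddCommGroup g0 hcont (‖f.1‖ + ε) (fun x => by
      have a := f.1.norm_coe_le_norm x
      have b := hclose x
      have : g0 x = (g0 x - f.1 x) + f.1 x := by ring
      rw [this]
      refine (norm_add_le _ _).trans ?_
      rw [Real.norm_eq_abs (g0 x - f.1 x)]
      linarith)
  refine ⟨⟨g1, fun x y => (hom x y).trans (min_le_left _ _)⟩, L, hlip, ?_⟩
  change dist g1 f.1 ≤ ε
  rw [BoundedContinuousFunction.dist_le hε.le]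
  intro x
  rw [Real.dist_eq]
  exact hclose x

instance (p : ℕ) (α : ℝ) (F : Set (Euc p)) : CompleteSpace (HolderBall p α F) := by
  have : IsClosed {f : BoundedContinuousFunction ↥F ℝ |
      ∀ x y : ↥F, |f x - f y| ≤ dist x y ^ α} := by
    simp only [ofPred_forall]
    refine isClosed_iInter fun x => isClosed_iInter fun y => isClosed_le ?_ continuous_const
    exact ((continuous_eval_const x).sub
      (continuous_eval_const y)).abs
  exact this.completeSpace_coe

/-- Functions that are approximated by `N`-Lipschitz functions at scale `2^{-N}`. -/
def goodU (p : ℕ) (α : ℝ) (F : Set (Euc p)) (n : ℕ) : Set (HolderBall p α F) :=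
  {f | ∃ N : ℕ, n ≤ N ∧ ∃ g : HolderBall p α F,
    (∀ x y : ↥F, |g.1 x - g.1 y| ≤ N * dist x y) ∧ dist f g < ((2 : ℝ) ^ N)⁻¹}

lemma goodU_open (p : ℕ) (α : ℝ) (F : Set (Euc p)) (n : ℕ) : IsOpen (goodU p α F n) := by
  rw [Metric.isOpen_iff]
  rintro f ⟨N, hN, g, hg, hd⟩
  refine ⟨((2 : ℝ) ^ N)⁻¹ - dist f g, by linarith, fun f' hf' => ⟨N, hN, g, hg, ?_⟩⟩
  rw [Metric.mem_ball] at hf'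
  linarith [dist_triangle f' f g]

lemma goodU_dense (p : ℕ) {α : ℝ} (h0 : 0 < α) (h1 : α ≤ 1) (F : Set (Euc p)) (n : ℕ) :
    Dense (goodU p α F n) := by
  rw [Metric.dense_iff]
  intro f ε hε
  obtain ⟨g, L, hg, hd⟩ := exists_lip h0 h1 f (half_pos hε)
  refine ⟨g, by rw [Metric.mem_ball]; linarith, max n ⌈L⌉₊, le_max_left _ _, g, fun x y => ?_, ?_⟩
  · refine (hg x y).trans ?_
    gcongr
    exact (Nat.le_ceil L).trans (by exact_mod_cast le_max_right _ _)
  · rw [dist_self]; positivity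

lemma goodU_est {p : ℕ} {α : ℝ} {F : Set (Euc p)} {f : HolderBall p α F}
    (hf : ∀ n, f ∈ goodU p α F n) (n : ℕ) :
    ∃ N : ℕ, n ≤ N ∧ ∀ x y : ↥F, |f.1 x - f.1 y| ≤ N * dist x y + 2 * ((2 : ℝ) ^ N)⁻¹ := by
  obtain ⟨N, hN, g, hg, hd⟩ := hf n
  refine ⟨N, hN, fun x y => ?_⟩
  have a : ∀ z, |f.1 z - g.1 z| ≤ ((2 : ℝ) ^ N)⁻¹ := fun z => by
    rw [← Real.dist_eq]
    exact (BoundedContinuousFunction.dist_coe_le_dist (f := f.1) (g := g.1) z).trans hd.le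
  have := hg x y
  have ax := a x
  have ay := a y
  rw [abs_le] at *
  constructor <;> linarith

/-- Indices of the grid cubes meeting `F`. -/
def cubeIdx (p : ℕ) (F : Set (Euc p)) (N : ℕ) : Set (Fin p → ℤ) :=
  {k : Fin p → ℤ | (gridCube p N k ∩ F).Nonempty}

lemma cubeIdx_bound {p : ℕ} {F : Set (Euc p)} (hF : Bornology.IsBounded F) :
    ∃ C : ℕ, 1 ≤ C ∧ ∀ N, (cubeIdx p F N).Finite ∧ cubeCount p F N ≤ (C * 2 ^ N) ^ p := by
  obtain ⟨R0, hR0⟩ := hF.exists_norm_le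
  obtain ⟨R, hR⟩ := exists_nat_ge R0
  refine ⟨2 * R + 3, by omega, fun N => ?_⟩
  let M : ℤ := R * 2 ^ N + 1
  have hsub : cubeIdx p F N ⊆ ↑(Fintype.piFinset fun _ : Fin p => Finset.Icc (-M) M) := by
    rintro k ⟨x, hx, hxF⟩
    rw [Finset.mem_coe, Fintype.mem_piFinset]
    intro i
    have h1 : |x i| ≤ R := by
      have := (EuclideanSpace.norm_eq x) ▸ PiLp.norm_apply_le x i
      have h2 := PiLp.norm_apply_le x i
      rw [Real.norm_eq_abs] at h2
      exact h2.trans ((hR0 x hxF).trans hR)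
    obtain ⟨ha, hb⟩ := hx i
    rw [abs_le] at h1
    have e : (2 : ℝ) ^ (-(N : ℤ)) = ((2 : ℝ) ^ N)⁻¹ := by simp
    rw [e, ← div_eq_mul_inv] at ha hb
    have hp : (0 : ℝ) < 2 ^ N := by positivity
    rw [div_le_iff₀ hp] at ha
    rw [le_div_iff₀ hp] at hb
    have h3 : (k i : ℝ) ≤ M := by
      simp only [M]; push_cast
      nlinarith
    have h4 : -(M : ℝ) ≤ k i := by
      simp only [M]; push_cast
      nlinarith
    rw [Finset.mem_Icc]
    exact ⟨by exact_mod_cast h4, by exact_mod_cast h3⟩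
  refine ⟨(Finset.finite_toSet _).subset hsub, ?_⟩
  have h := Set.ncard_le_ncard hsub (Finset.finite_toSet _)
  rw [Set.ncard_coe_finset, Fintype.card_piFinset_const, Int.card_Icc] at h
  refine h.trans ?_
  gcongr
  have h1 : (1 : ℤ) ≤ 2 ^ N := one_le_pow₀ (by norm_num)
  simp only [M]
  zify
  rw [Int.toNat_of_nonneg (by nlinarith [Int.natCast_nonneg R])]
  push_cast
  nlinarith [Int.natCast_nonneg R]

lemma count_le {p : ℕ} {F : Set (Euc p)} (hF : Bornology.IsBounded F) {b : ℝ}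
    (hb : upperBoxDim p F < b) :
    ∀ᶠ N : ℕ in atTop, (cubeCount p F N : ℝ) ≤ (2 : ℝ) ^ (b * N) := by
  obtain ⟨C, hC1, hC⟩ := cubeIdx_bound hF
  have hC1' : (1 : ℝ) ≤ C := by exact_mod_cast hC1
  have hlC : 0 ≤ Real.logb 2 C := Real.logb_nonneg (by norm_num) hC1'
  have hbd : IsBoundedUnder (· ≤ ·) atTop
      (fun N : ℕ => Real.logb 2 (cubeCount p F N) / N) := by
    refine isBoundedUnder_of ⟨p * (Real.logb 2 C + 1), fun N => ?_⟩
    rcases Nat.eq_zero_or_pos N with rfl | hN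
    · simp; positivity
    have hN' : (1 : ℝ) ≤ N := by exact_mod_cast hN
    rw [div_le_iff₀ (by linarith)]
    rcases Nat.eq_zero_or_pos (cubeCount p F N) with h0 | h0
    · rw [h0]; simp; positivity
    have h1 : (cubeCount p F N : ℝ) ≤ ((C : ℝ) * 2 ^ N) ^ p := by exact_mod_cast (hC N).2
    have h2 := Real.logb_le_logb_of_le (b := 2) (by norm_num) (by exact_mod_cast h0) h1
    rw [Real.logb_pow, Real.logb_mul (by linarith) (by positivity), Real.logb_pow,
      Real.logb_self_eq_one (by norm_num)] at h2
    refine h2.trans ?_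
    have hp : (0 : ℝ) ≤ p := by positivity
    rw [mul_assoc]
    gcongr
    nlinarith
  filter_upwards [eventually_lt_of_limsup_lt hb hbd, eventually_ge_atTop 1] with N h hN
  have hN' : (1 : ℝ) ≤ N := by exact_mod_cast hN
  rcases Nat.eq_zero_or_pos (cubeCount p F N) with h0 | h0
  · rw [h0]; simp; positivity
  rw [div_lt_iff₀ (by linarith), Real.logb_lt_iff_lt_rpow (by norm_num) (by exact_mod_cast h0)] at h
  exact h.le

lemma cube_dist {p N : ℕ} {k : Fin p → ℤ} {x y : Euc p} (hx : x ∈ gridCube p N k)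
    (hy : y ∈ gridCube p N k) : dist x y ≤ p * ((2 : ℝ) ^ N)⁻¹ := by
  have e : (2 : ℝ) ^ (-(N : ℤ)) = ((2 : ℝ) ^ N)⁻¹ := by simp
  have h : ∀ i, dist (x i) (y i) ≤ ((2 : ℝ) ^ N)⁻¹ := fun i => by
    obtain ⟨a, b⟩ := hx i
    obtain ⟨c, d⟩ := hy i
    rw [e] at a b c d
    rw [Real.dist_eq, abs_le]
    constructor <;> linarith
  rw [EuclideanSpace.dist_eq]
  apply Real.sqrt_le_iff.2
  refine ⟨by positivity, ?_⟩
  calc ∑ i, dist (x i) (y i) ^ 2 ≤ ∑ i : Fin p, (((2 : ℝ) ^ N)⁻¹) ^ 2 := by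
        gcongr with i; exact h i
    _ = p * (((2 : ℝ) ^ N)⁻¹) ^ 2 := by simp
    _ ≤ (p : ℝ) ^ 2 * (((2 : ℝ) ^ N)⁻¹) ^ 2 := by
        gcongr
        exact_mod_cast Nat.le_self_pow (by norm_num) p
    _ = _ := by ring

lemma exists_cube (p N : ℕ) (x : Euc p) : ∃ k, x ∈ gridCube p N k := by
  refine ⟨fun i => ⌊x i * 2 ^ N⌋, fun i => ?_⟩
  have e : (2 : ℝ) ^ (-(N : ℤ)) = ((2 : ℝ) ^ N)⁻¹ := by simp
  have hp : (0 : ℝ) < 2 ^ N := by positivity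
  rw [e, ← div_eq_mul_inv, ← div_eq_mul_inv, div_le_iff₀ hp, le_div_iff₀ hp]
  exact ⟨Int.floor_le _, (Int.lt_floor_add_one _).le⟩

lemma bound_tendsto (p : ℕ) {b s : ℝ} (h : b < 1 + s) :
    Tendsto (fun N : ℕ => (2 : ℝ) ^ (b * N) * (2 * ((p * N + 2) * ((2 : ℝ) ^ N)⁻¹) *
      (p * ((2 : ℝ) ^ N)⁻¹) ^ s)) atTop (nhds 0) := by
  set q : ℝ := (2 : ℝ) ^ (b - 1 - s) with hq
  have hq0 : 0 ≤ q := by positivity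
  have hq1 : q < 1 := Real.rpow_lt_one_of_one_lt_of_neg (by norm_num) (by linarith)
  have t1 := tendsto_self_mul_const_pow_of_lt_one hq0 hq1
  have t2 := tendsto_pow_atTop_nhds_zero_of_lt_one hq0 hq1
  have t3 : Tendsto (fun N : ℕ => 2 * (p : ℝ) ^ s * (p * (N * q ^ N) + 2 * q ^ N)) atTop
      (nhds (2 * (p : ℝ) ^ s * (p * 0 + 2 * 0))) :=
    ((t1.const_mul _).add (t2.const_mul _)).const_mul _
  simp only [mul_zero, add_zero] at t3
  refine t3.congr fun N => ?_
  have e1 : q ^ N = (2 : ℝ) ^ (b * N) * ((2 : ℝ) ^ N)⁻¹ * (((2 : ℝ) ^ N)⁻¹) ^ s := by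
    rw [hq, ← Real.rpow_natCast, ← Real.rpow_mul (by norm_num), ← Real.rpow_natCast 2 N,
      ← Real.rpow_neg (by norm_num), ← Real.rpow_mul (by norm_num),
      ← Real.rpow_add (by norm_num), ← Real.rpow_add (by norm_num)]
    ring_nf
  rw [Real.mul_rpow (by positivity) (by positivity), e1]
  ring

open scoped ENNReal in
lemma ae_dimH {p : ℕ} {F : Set (Euc p)} (hF : Bornology.IsBounded F) (f : ↥F → ℝ)
    (hf : ∀ n : ℕ, ∃ N : ℕ, n ≤ N ∧
      ∀ x y : ↥F, |f x - f y| ≤ N * dist x y + 2 * ((2 : ℝ) ^ N)⁻¹)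
    {s : ℝ} (hs0 : 0 < s) (hs : upperBoxDim p F - 1 < s) :
    ∀ᵐ r : ℝ, dimH (f ⁻¹' {r}) ≤ ENNReal.ofReal s := by
  obtain ⟨C, -, hC⟩ := cubeIdx_bound hF
  obtain ⟨b, hb1, hb2⟩ := exists_between (show upperBoxDim p F < 1 + s by linarith)
  choose N hN hfN using hf
  have hNt : Tendsto N atTop atTop := tendsto_atTop_mono hN tendsto_id
  have fint : ∀ n, Fintype (cubeIdx p F (N n)) := fun n => (hC (N n)).1.fintype
  have hpt : ∀ n, ∀ k : cubeIdx p F (N n), ∃ x : ↥F, x.1 ∈ gridCube p (N n) k.1 := by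
    rintro n ⟨k, x, hx, hxF⟩
    exact ⟨⟨x, hxF⟩, hx⟩
  choose c hc using hpt
  let ρ : ℕ → ℝ := fun n => (p * N n + 2) * ((2 : ℝ) ^ N n)⁻¹
  let δ : ℕ → ℝ := fun n => p * ((2 : ℝ) ^ N n)⁻¹
  let h : ℕ → ℝ → ℝ≥0∞ := fun n r => ∑ k : cubeIdx p F (N n),
    (closedBall (f (c n k)) (ρ n)).indicator (fun _ => ENNReal.ofReal (δ n ^ s)) r
  have hmeas : ∀ n, Measurable (h n) := fun n =>
    Finset.measurable_sum _ fun k _ => measurable_const.indicator measurableSet_closedBall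
  have hρ : ∀ n, 0 ≤ ρ n := fun n => by positivity
  have hδ : ∀ n, 0 ≤ δ n := fun n => by positivity
  have hint : ∀ n, ∫⁻ r, h n r =
      ENNReal.ofReal (cubeCount p F (N n) * (2 * ρ n * δ n ^ s)) := fun n => by
    have hcard : Fintype.card (cubeIdx p F (N n)) = cubeCount p F (N n) := by
      rw [← Nat.card_eq_fintype_card]; rfl
    simp only [h]
    rw [lintegral_finsetSum _ fun k _ => measurable_const.indicator measurableSet_closedBall]
    simp only [lintegral_indicator_const measurableSet_closedBall, Real.volume_closedBall,
      Finset.sum_const, Finset.card_univ, hcard, nsmul_eq_mul]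
    have hρn := hρ n
    rw [ENNReal.ofReal_mul (p := (cubeCount p F (N n) : ℝ)) (by positivity),
      ENNReal.ofReal_mul (p := 2 * ρ n) (by positivity),
      ENNReal.ofReal_natCast, mul_comm (ENNReal.ofReal (δ n ^ s))]
  have hlim : Tendsto (fun n => ∫⁻ r, h n r) atTop (nhds 0) := by
    have t := ENNReal.tendsto_ofReal ((bound_tendsto p hb2).comp hNt)
    rw [ENNReal.ofReal_zero] at t
    refine tendsto_of_tendsto_of_tendsto_of_le_of_le' tendsto_const_nhds t
      (Eventually.of_forall fun _ => zero_le) ?_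
    filter_upwards [hNt.eventually (count_le hF hb1)] with n hn
    rw [hint]
    apply ENNReal.ofReal_le_ofReal
    have := hρ n
    have := hδ n
    exact mul_le_mul_of_nonneg_right hn (by positivity)
  have hzero : ∫⁻ r, liminf (fun n => h n r) atTop = 0 := by
    refine le_antisymm ((lintegral_liminf_le hmeas).trans ?_) (zero_le)
    rw [hlim.liminf_eq]
  rw [lintegral_eq_zero_iff (Measurable.liminf hmeas)] at hzero
  filter_upwards [hzero] with r hr
  simp only [Pi.zero_apply] at hr
  have hδ0 : Tendsto (fun n => ENNReal.ofReal (δ n)) atTop (nhds 0) := by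
    have t : Tendsto (fun n : ℕ => (p : ℝ) * ((2 : ℝ) ^ n)⁻¹) atTop (nhds (p * 0)) := by
      refine Tendsto.const_mul _ ?_
      simp only [← inv_pow]
      exact tendsto_pow_atTop_nhds_zero_of_lt_one (by norm_num) (by norm_num)
    rw [mul_zero] at t
    have t' := ENNReal.tendsto_ofReal (t.comp hNt)
    rw [ENNReal.ofReal_zero] at t'
    exact t'
  have hdiam : ∀ n (k : cubeIdx p F (N n)),
      ediam ({x : ↥F | x.1 ∈ gridCube p (N n) k.1} ∩ f ⁻¹' {r}) ≤ ENNReal.ofReal (δ n) :=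
    fun n k => Metric.ediam_le_of_forall_dist_le fun x hx y hy => cube_dist hx.1 hy.1
  have key := Measure.hausdorffMeasure_le_liminf_sum (X := ↥F) s (f ⁻¹' {r})
    (l := atTop) (ι := fun n => cubeIdx p F (N n)) (fun n => ENNReal.ofReal (δ n)) hδ0
    (fun n k => {x : ↥F | x.1 ∈ gridCube p (N n) k.1} ∩ f ⁻¹' {r})
    (Eventually.of_forall hdiam)
    (Eventually.of_forall fun n x hx => by
      obtain ⟨k, hk⟩ := exists_cube p (N n) x.1
      exact mem_iUnion.2 ⟨⟨k, x.1, hk, x.2⟩, hk, hx⟩)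
  have hle : Measure.hausdorffMeasure s (f ⁻¹' {r}) ≤ liminf (fun n => h n r) atTop := by
    refine key.trans (liminf_le_liminf (Eventually.of_forall fun n => ?_))
    refine Finset.sum_le_sum fun k _ => ?_
    rcases ({x : ↥F | x.1 ∈ gridCube p (N n) k.1} ∩ f ⁻¹' {r}).eq_empty_or_nonempty with he | ⟨x, hx, hxr⟩
    · rw [he, Metric.ediam_empty, ENNReal.zero_rpow_of_pos hs0]
      exact zero_le
    · have hmem : r ∈ closedBall (f (c n k)) (ρ n) := by
        rw [mem_closedBall, Real.dist_eq, ← (show f x = r from hxr)]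
        refine (hfN n x (c n k)).trans ?_
        have hd : dist x (c n k) ≤ δ n := cube_dist hx (hc n k)
        have hNn : (0 : ℝ) ≤ N n := by positivity
        calc _ ≤ N n * δ n + 2 * ((2 : ℝ) ^ N n)⁻¹ := by gcongr
          _ = ρ n := by simp only [ρ, δ]; ring
      rw [indicator_of_mem hmem, ← ENNReal.ofReal_rpow_of_nonneg (hδ n) hs0.le]
      exact ENNReal.rpow_le_rpow (hdiam n k) hs0.le
  rw [hr] at hle
  have : Measure.hausdorffMeasure ((s.toNNReal : NNReal) : ℝ) (f ⁻¹' {r}) ≠ ∞ := by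
    rw [Real.coe_toNNReal s hs0.le]
    exact (hle.trans_lt ENNReal.zero_lt_top).ne
  exact dimH_le_of_hausdorffMeasure_ne_top this

lemma Dstar_le {p : ℕ} {F : Set (Euc p)} (hF : Bornology.IsBounded F) (f : ↥F → ℝ)
    (hf : ∀ n : ℕ, ∃ N : ℕ, n ≤ N ∧
      ∀ x y : ↥F, |f x - f y| ≤ N * dist x y + 2 * ((2 : ℝ) ^ N)⁻¹) :
    DstarOn f univ ≤ max 0 (upperBoxDim p F - 1) := by
  refine Real.sSup_le (fun d hd => ?_) (le_max_left _ _)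
  by_contra! hlt
  obtain ⟨s, hs1, hs2⟩ := exists_between hlt
  have hs0 : 0 < s := (le_max_left _ _).trans_lt hs1
  have ae := ae_dimH hF f hf hs0 ((le_max_right _ _).trans_lt hs1)
  refine (ne_of_gt hd) (measure_mono_null (fun r hr => ?_) (ae_iff.1 ae))
  simp only [mem_ofPred_eq, inter_univ, not_le] at hr ⊢
  exact ((ENNReal.ofReal_lt_ofReal_iff (hs0.trans hs2)).2 hs2).trans_le hr

lemma Dstar_nonneg {p : ℕ} {F : Set (Euc p)} (f : ↥F → ℝ) : 0 ≤ DstarOn f univ := by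
  unfold DstarOn
  refine Real.sSup_nonneg' ⟨0, ?_, le_rfl⟩
  simp

theorem stmt10 (p : ℕ) (F : Set (Euc p))
    (hF : Bornology.IsBounded F) (hFm : MeasurableSet F)
    (α : ℝ) (hα : 0 < α) (hα1 : α ≤ 1) :
    DstarAlpha p α F ≤ max 0 (upperBoxDim p F - 1) := by
  refine Real.sSup_le ?_ (le_max_left _ _)
  rintro v ⟨G, hGd, hG, rfl⟩
  have hU := dense_iInter_of_isOpen_nat (goodU_open p α F) (goodU_dense p hα hα1 F)
  have hUG : IsGδ (⋂ n, goodU p α F n) := IsGδ.iInter_of_isOpen (goodU_open p α F)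
  have hd := Dense.inter_of_Gδ hG hUG hGd hU
  have : Nonempty (HolderBall p α F) :=
    ⟨⟨0, fun x y => by simpa using Real.rpow_nonneg dist_nonneg α⟩⟩
  obtain ⟨f, hfG, hfU⟩ := hd.nonempty
  refine (csInf_le ⟨0, ?_⟩ (mem_image_of_mem _ hfG)).trans
    (Dstar_le hF _ (goodU_est (mem_iInter.1 hfU)))
  rintro _ ⟨g, -, rfl⟩
  exact Dstar_nonneg _
end
end

section
/- Let F ⊂ ℝ^p be compact. The function α ↦ D_*(α, F) is monotone increasing on (0, 1]: if 0 < α ≤ α' ≤ 1 then D_*(α, F) ≤ D_*(α', F). -/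
open Set Metric MeasureTheory Filter

noncomputable section

open scoped ENNReal NNReal Topology

/-- Open covers with small `s`-dimensional sum. -/
def Cov {X : Type*} [MetricSpace X] (s : ℝ) (ε : ℝ≥0∞) (S : Set X) : Prop :=
  ∃ t : ℕ → Set X, (∀ n, IsOpen (t n)) ∧ S ⊆ ⋃ n, t n ∧ ∑' n, ediam (t n) ^ s < ε

lemma exists_open_enlarge {X : Type*} [MetricSpace X] {s : ℝ} (hs : 0 < s) (t : Set X)
    (ht : ediam t ≤ 1) {η : ℝ≥0∞} (hη : 0 < η) :
    ∃ u, IsOpen u ∧ t ⊆ u ∧ ediam u ^ s ≤ ediam t ^ s + η := by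
  have hc : Tendsto (fun δ : ℝ≥0 => (ediam t + 2 * (δ : ℝ≥0∞)) ^ s) (𝓝 0)
      (𝓝 (ediam t ^ s)) := by
    have h1 : Continuous (fun δ : ℝ≥0 => (ediam t + 2 * (δ : ℝ≥0∞)) ^ s) := by
      refine ENNReal.continuous_rpow_const.comp ?_
      refine continuous_const.add ?_
      exact (ENNReal.continuous_const_mul (by simp)).comp ENNReal.continuous_coe
    have := h1.tendsto 0
    simpa using this
  have hfin : ediam t ^ s ≠ ∞ :=
    ENNReal.rpow_ne_top_of_nonneg hs.le (ne_top_of_le_ne_top (by simp) ht)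
  have hlt : ediam t ^ s < ediam t ^ s + η := ENNReal.lt_add_right hfin hη.ne'
  have he := hc.eventually (gt_mem_nhds hlt)
  have he2 : ∀ᶠ δ : ℝ≥0 in 𝓝[>] 0, (ediam t + 2 * (δ : ℝ≥0∞)) ^ s < ediam t ^ s + η :=
    he.filter_mono nhdsWithin_le_nhds
  obtain ⟨δ, h1, h2⟩ := (he2.and self_mem_nhdsWithin).exists
  refine ⟨thickening δ t, isOpen_thickening, self_subset_thickening (by exact_mod_cast h2) t, ?_⟩
  exact (ENNReal.rpow_le_rpow (ediam_thickening_le δ) hs.le).trans h1.le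

lemma cov_of_null {X : Type*} [MetricSpace X] [MeasurableSpace X] [BorelSpace X] {s : ℝ}
    (hs : 0 < s) {ε : ℝ≥0∞} (hε : 0 < ε) {S : Set X} (h : Measure.hausdorffMeasure s S = 0) :
    Cov s ε S := by
  rw [Measure.hausdorffMeasure_apply] at h
  simp only [ENNReal.iSup_eq_zero] at h
  have h1 := h 1 one_pos
  obtain ⟨δ, hδ0, hδ1⟩ := ENNReal.exists_pos_sum_of_countable (ε := min ε 1 / 2)
    (by simp [hε.ne']) ℕ
  have hlt : (0 : ℝ≥0∞) < min ε 1 / 2 := by simp [hε.ne', pos_iff_ne_zero]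
  rw [← h1] at hlt
  simp only [iInf_lt_iff] at hlt
  obtain ⟨t, hSt, ht1, hsum⟩ := hlt
  have : ∀ n, ∃ u, IsOpen u ∧ t n ⊆ u ∧ ediam u ^ s ≤ ediam (t n) ^ s + δ n := fun n =>
    exists_open_enlarge hs (t n) (ht1 n) (by exact_mod_cast hδ0 n)
  choose u hu1 hu2 hu3 using this
  refine ⟨u, hu1, hSt.trans (iUnion_mono hu2), ?_⟩
  have heq : ∀ n, (⨆ _ : (t n).Nonempty, ediam (t n) ^ s) = ediam (t n) ^ s := by
    intro n
    rcases (t n).eq_empty_or_nonempty with h | h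
    · simp [h, hs]
    · simp [h]
  simp only [heq] at hsum
  calc ∑' n, ediam (u n) ^ s ≤ ∑' n, (ediam (t n) ^ s + δ n) := ENNReal.tsum_le_tsum hu3
    _ = ∑' n, ediam (t n) ^ s + ∑' n, (δ n : ℝ≥0∞) := ENNReal.tsum_add
    _ < min ε 1 / 2 + min ε 1 / 2 := by
      exact ENNReal.add_lt_add hsum hδ1
    _ = min ε 1 := ENNReal.add_halves _
    _ ≤ ε := min_le_left _ _

lemma null_of_cov {X : Type*} [MetricSpace X] [MeasurableSpace X] [BorelSpace X] {s : ℝ}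
    (hs : 0 < s) {S : Set X} (h : ∀ m : ℕ, Cov s ((m : ℝ≥0∞) + 1)⁻¹ S) :
    Measure.hausdorffMeasure s S = 0 := by
  choose t ht1 ht2 ht3 using h
  have hlim : Tendsto (fun m : ℕ => ((m : ℝ≥0∞) + 1)⁻¹) atTop (𝓝 0) := by
    have := (tendsto_add_atTop_iff_nat 1).2 ENNReal.tendsto_inv_nat_nhds_zero
    simpa using this
  have hr : Tendsto (fun m : ℕ => (((m : ℝ≥0∞) + 1)⁻¹) ^ s⁻¹) atTop (𝓝 0) := by
    have := (ENNReal.continuous_rpow_const (y := s⁻¹)).tendsto 0 |>.comp hlim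
    have h0 : (0 : ℝ≥0∞) ^ s⁻¹ = 0 := ENNReal.zero_rpow_of_pos (by positivity)
    rw [h0] at this
    exact this
  have := Measure.hausdorffMeasure_le_liminf_tsum s S _ hr t (Eventually.of_forall fun m i => ?_)
    (Eventually.of_forall ht2)
  · have h2 : liminf (fun n => ∑' i, ediam (t n i) ^ s) atTop = 0 := by
      refine Tendsto.liminf_eq ?_
      exact tendsto_of_tendsto_of_tendsto_of_le_of_le tendsto_const_nhds hlim
        (fun _ => zero_le) (fun m => (ht3 m).le)
    rw [h2] at this
    exact le_antisymm this zero_le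
  · rw [ENNReal.le_rpow_inv_iff hs]
    exact (ENNReal.le_tsum i).trans (ht3 m).le

/-- Almost every level set in `A` has dimension at most `d`. -/
def Good {X : Type*} [MetricSpace X] (d : ℝ≥0) (f : X → ℝ) (A : Set X) : Prop :=
  volume {r : ℝ | (d : ℝ≥0∞) < dimH (f ⁻¹' {r} ∩ A)} = 0

def Ebad {X : Type*} [MetricSpace X] (d : ℝ≥0) (n m : ℕ) (f : X → ℝ) (A : Set X) : Set ℝ :=
  {r : ℝ | ¬ Cov ((d + ((n : ℝ≥0) + 1)⁻¹ : ℝ≥0) : ℝ) ((m : ℝ≥0∞) + 1)⁻¹ (f ⁻¹' {r} ∩ A)}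

lemma dimH_gt_iff {X : Type*} [MetricSpace X] [MeasurableSpace X] [BorelSpace X]
    (d : ℝ≥0) (S : Set X) :
    (d : ℝ≥0∞) < dimH S ↔
      ∃ n m : ℕ, ¬ Cov ((d + ((n : ℝ≥0) + 1)⁻¹ : ℝ≥0) : ℝ) ((m : ℝ≥0∞) + 1)⁻¹ S := by
  have hpos : ∀ n : ℕ, 0 < ((n : ℝ≥0) + 1)⁻¹ := fun n => by positivity
  constructor
  · intro h
    by_contra! hc
    have h1 : ∀ n : ℕ, dimH S ≤ ((d + ((n : ℝ≥0) + 1)⁻¹ : ℝ≥0) : ℝ≥0∞) := fun n => by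
      refine dimH_le_of_hausdorffMeasure_ne_top ?_
      rw [null_of_cov (by exact_mod_cast add_pos_of_nonneg_of_pos (zero_le : 0 ≤ d) (hpos n)) (hc n)]
      simp
    have hlim : Tendsto (fun n : ℕ => ((d + ((n : ℝ≥0) + 1)⁻¹ : ℝ≥0) : ℝ≥0∞)) atTop (𝓝 d) := by
      rw [ENNReal.tendsto_coe]
      have := (tendsto_const_nhds (x := d)).add (tendsto_one_div_add_atTop_nhds_zero_nat (𝕜 := ℝ≥0))
      simpa using this
    exact absurd (ge_of_tendsto' hlim h1) (not_le.2 h)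
  · rintro ⟨n, m, h⟩
    by_contra! hc
    refine h (cov_of_null (by exact_mod_cast add_pos_of_nonneg_of_pos (zero_le : 0 ≤ d) (hpos n))
      (by simp) ?_)
    refine hausdorffMeasure_of_dimH_lt (hc.trans_lt ?_)
    exact_mod_cast lt_add_of_pos_right d (hpos n)

lemma good_iff {X : Type*} [MetricSpace X] [MeasurableSpace X] [BorelSpace X]
    (d : ℝ≥0) (f : X → ℝ) (A : Set X) :
    Good d f A ↔ ∀ n m k : ℕ, volume (Ebad d n m f A) < ((k : ℝ≥0∞) + 1)⁻¹ := by
  have : {r : ℝ | (d : ℝ≥0∞) < dimH (f ⁻¹' {r} ∩ A)} = ⋃ n, ⋃ m, Ebad d n m f A := by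
    ext r
    simp only [mem_ofPred_eq, dimH_gt_iff, mem_iUnion, Ebad]
  unfold Good
  rw [this]
  simp only [measure_iUnion_null_iff]
  refine forall_congr' fun n => forall_congr' fun m => ?_
  constructor
  · intro h k
    rw [h]; simp
  · intro h
    have hlim : Tendsto (fun m : ℕ => ((m : ℝ≥0∞) + 1)⁻¹) atTop (𝓝 0) := by
      have := (tendsto_add_atTop_iff_nat 1).2 ENNReal.tendsto_inv_nat_nhds_zero
      simpa using this
    exact le_antisymm (ge_of_tendsto' hlim fun k => (h k).le) zero_le

section Space

variable {p : ℕ} {α : ℝ} {F : Set (Euc p)}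

lemma hb_continuous_val : Continuous (fun f : HolderBall p α F => f.1) :=
  continuous_subtype_val

lemma hb_continuous_eval : Continuous (fun q : HolderBall p α F × ↥F => q.1.1 q.2) := by
  have : Continuous (fun q : BoundedContinuousFunction ↥F ℝ × ↥F => q.1 q.2) := continuous_eval
  exact this.comp ((hb_continuous_val.comp continuous_fst).prodMk continuous_snd)

lemma hb_dist (f g : HolderBall p α F) : dist f g = dist f.1 g.1 := rfl

instance hb_complete : CompleteSpace (HolderBall p α F) := by
  have hc : IsClosed {f : BoundedContinuousFunction ↥F ℝ |
      ∀ x y : ↥F, |f x - f y| ≤ dist x y ^ α} := by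
    have : {f : BoundedContinuousFunction ↥F ℝ | ∀ x y : ↥F, |f x - f y| ≤ dist x y ^ α}
        = ⋂ x, ⋂ y, {f : BoundedContinuousFunction ↥F ℝ | |f x - f y| ≤ dist x y ^ α} := by
      ext f; simp
    rw [this]
    refine isClosed_iInter fun x => isClosed_iInter fun y => isClosed_le ?_ continuous_const
    exact ((continuous_eval_const x).sub (continuous_eval_const y)).abs
  exact hc.completeSpace_coe

lemma hb_mk (hF : IsCompact F) (h0 : 0 < α) (f : ↥F → ℝ)
    (hf : ∀ x y : ↥F, |f x - f y| ≤ dist x y ^ α) :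
    ∃ g : HolderBall p α F, ∀ x, g.1 x = f x := by
  have : CompactSpace ↥F := isCompact_iff_compactSpace.mp hF
  have hc : Continuous f := by
    rw [continuous_iff_continuousAt]
    intro x
    rw [ContinuousAt, tendsto_iff_dist_tendsto_zero]
    refine squeeze_zero (fun _ => dist_nonneg) (fun y => hf y x) ?_
    have h1 : Tendsto (fun y : ↥F => dist y x) (𝓝 x) (𝓝 0) := by
      have : Continuous (fun y : ↥F => dist y x) := by fun_prop
      simpa using this.tendsto x
    have := h1.rpow_const (p := α) (Or.inr h0.le)
    simpa [Real.zero_rpow h0.ne'] using this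
  exact ⟨⟨BoundedContinuousFunction.mkOfCompact ⟨f, hc⟩, hf⟩, fun _ => rfl⟩

lemma cov_open (hF : IsCompact F) {A : Set ↥F} (hA : IsClosed A) {s : ℝ} {ε : ℝ≥0∞}
    (f : HolderBall p α F) (r : ℝ) (h : Cov s ε ((fun x => f.1 x) ⁻¹' {r} ∩ A)) :
    ∀ᶠ q : HolderBall p α F × ℝ in 𝓝 (f, r), Cov s ε ((fun x => q.1.1 x) ⁻¹' {q.2} ∩ A) := by
  have : CompactSpace ↥F := isCompact_iff_compactSpace.mp hF
  obtain ⟨t, ht1, ht2, ht3⟩ := h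
  have hU : IsOpen (⋃ n, t n) := isOpen_iUnion ht1
  have hK : IsCompact (A \ ⋃ n, t n) := (hA.sdiff hU).isCompact
  have := hK.eventually_forall_of_forall_eventually (x₀ := (f, r))
    (P := fun q x => q.1.1 x ≠ q.2) (fun y hy => ?_)
  · filter_upwards [this] with q hq
    refine ⟨t, ht1, ?_, ht3⟩
    rintro x ⟨hx1, hx2⟩
    by_contra hx
    exact hq x ⟨hx2, hx⟩ hx1
  · have hcont : Continuous (fun z : (HolderBall p α F × ℝ) × ↥F => z.1.1.1 z.2) :=
      hb_continuous_eval.comp ((continuous_fst.comp continuous_fst).prodMk continuous_snd)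
    have ho : IsOpen {z : (HolderBall p α F × ℝ) × ↥F | z.1.1.1 z.2 ≠ z.1.2} :=
      isOpen_ne_fun hcont (continuous_snd.comp continuous_fst)
    refine ho.mem_nhds ?_
    intro he
    exact hy.2 (ht2 ⟨he, hy.1⟩)

lemma isOpen_ebad (hF : IsCompact F) {A : Set ↥F} (hA : IsClosed A) (d : ℝ≥0) (n m : ℕ)
    (c : ℝ≥0∞) :
    IsOpen {f : HolderBall p α F | volume (Ebad d n m (fun x => f.1 x) A) < c} := by
  rw [isOpen_iff_mem_nhds]
  intro f hf
  obtain ⟨V, hV1, hV2, hV3⟩ := Set.exists_isOpen_lt_of_lt _ _ hf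
  set M := ‖f.1‖ + 1
  have hK : IsCompact (Icc (-M) M \ V) := isCompact_Icc.diff hV2
  have h1 := hK.eventually_forall_of_forall_eventually (x₀ := f)
    (P := fun g r => r ∉ Ebad d n m (fun x => g.1 x) A) (fun r hr => ?_)
  · have h2 : ∀ᶠ g in 𝓝 f, dist g f < 1 := Metric.ball_mem_nhds f one_pos
    filter_upwards [h1, h2] with g hg1 hg2
    refine lt_of_le_of_lt (measure_mono ?_) hV3
    intro r hr
    by_contra hrV
    refine hg1 r ⟨?_, hrV⟩ hr
    by_contra hrM
    apply hr
    have hemp : (fun x => g.1 x) ⁻¹' {r} ∩ A = ∅ := by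
      rw [Set.eq_empty_iff_forall_notMem]
      rintro x ⟨hx, -⟩
      have hx : g.1 x = r := hx
      apply hrM
      have h3 := g.1.norm_coe_le_norm x
      have h4 : ‖g.1‖ ≤ ‖f.1‖ + 1 := by
        have h5 : ‖g.1 - f.1‖ < 1 := by rw [← dist_eq_norm]; exact hg2
        have := norm_sub_norm_le g.1 f.1
        linarith
      rw [hx, Real.norm_eq_abs] at h3
      exact abs_le.1 (h3.trans h4)
    rw [hemp]
    refine ⟨fun _ => ∅, fun _ => isOpen_empty, empty_subset _, ?_⟩
    have : 0 < ((d + ((n : ℝ≥0) + 1)⁻¹ : ℝ≥0) : ℝ) := by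
      have : 0 < ((n : ℝ≥0) + 1)⁻¹ := by positivity
      exact_mod_cast add_pos_of_nonneg_of_pos (zero_le : 0 ≤ d) this
    simp only [ediam_empty, ENNReal.zero_rpow_of_pos this, tsum_zero]
    simp
  · have hr2 : r ∉ Ebad d n m (fun x => f.1 x) A := fun h => hr.2 (hV1 h)
    have hr3 := not_not.1 hr2
    filter_upwards [cov_open hF hA f r hr3] with q hq
    exact not_not.2 hq

lemma isGδ_good (hF : IsCompact F) {A : Set ↥F} (hA : IsClosed A) (d : ℝ≥0) :
    IsGδ {f : HolderBall p α F | Good d (fun x => f.1 x) A} := by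
  have : {f : HolderBall p α F | Good d (fun x => f.1 x) A} =
      ⋂ n : ℕ, ⋂ m : ℕ, ⋂ k : ℕ, {f : HolderBall p α F |
        volume (Ebad d n m (fun x => f.1 x) A) < ((k : ℝ≥0∞) + 1)⁻¹} := by
    ext f
    simp only [mem_ofPred_eq, good_iff, mem_iInter]
  rw [this]
  exact .iInter fun n => .iInter fun m => .iInter fun k => (isOpen_ebad hF hA d n m _).isGδ

lemma Good.congr_affine {X : Type*} [MetricSpace X] {d : ℝ≥0} {f g : X → ℝ} {A B : Set X}
    (hf : Good d f B) (hAB : A ⊆ B) (a b : ℝ) (ha : a ≠ 0) (h : ∀ x ∈ A, g x = a * f x + b) :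
    Good d g A := by
  unfold Good at *
  have hsub : {r : ℝ | (d : ℝ≥0∞) < dimH (g ⁻¹' {r} ∩ A)} ⊆
      (fun r => a * r + b) '' {r : ℝ | (d : ℝ≥0∞) < dimH (f ⁻¹' {r} ∩ B)} := by
    intro r hr
    refine ⟨(r - b) / a, ?_, by field_simp; ring⟩
    refine lt_of_lt_of_le hr (dimH_mono ?_)
    rintro x ⟨hx1, hx2⟩
    refine ⟨?_, hAB hx2⟩
    have h1 : g x = r := hx1
    rw [h x hx2] at h1
    show f x = (r - b) / a
    rw [← h1]; field_simp; ring
  refine measure_mono_null hsub ?_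
  have hl : LipschitzWith (Real.nnabs a) (fun r => a * r + b) := by
    refine LipschitzWith.of_dist_le_mul fun x y => ?_
    rw [Real.dist_eq, Real.dist_eq]
    have : a * x + b - (a * y + b) = a * (x - y) := by ring
    rw [this, abs_mul]; simp
  rw [← hausdorffMeasure_real] at *
  have := hl.hausdorffMeasure_image_le (d := 1) zero_le_one
    {r : ℝ | (d : ℝ≥0∞) < dimH (f ⁻¹' {r} ∩ B)}
  rw [hf, mul_zero] at this
  exact le_antisymm this zero_le

lemma clamp_real {a b a' b' η D : ℝ} (h1 : |a - b| ≤ D) (h2 : |a' - b'| ≤ D) :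
    |max (a' - η) (min (a' + η) a) - max (b' - η) (min (b' + η) b)| ≤ D := by
  rw [abs_le] at *
  constructor <;> grind

lemma clamp_real_near {a a' η : ℝ} (hη : 0 ≤ η) :
    |max (a' - η) (min (a' + η) a) - a'| ≤ η := by
  rw [abs_le] at *
  constructor <;> grind

lemma clamp_real_eq {a a' η : ℝ} (h : |a - a'| ≤ η) :
    max (a' - η) (min (a' + η) a) = a := by
  rw [abs_le] at *
  grind

lemma clamp_exists (hF : IsCompact F) (h0 : 0 < α) (f : HolderBall p α F) (v : ↥F → ℝ)
    (hv : ∀ x y : ↥F, |v x - v y| ≤ dist x y ^ α) {η : ℝ} (hη : 0 ≤ η) :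
    ∃ g : HolderBall p α F, dist g f ≤ η ∧ ∀ x, |v x - f.1 x| ≤ η → g.1 x = v x := by
  obtain ⟨g, hg⟩ := hb_mk hF h0 (fun x => max (f.1 x - η) (min (f.1 x + η) (v x))) (by
    intro x y
    exact clamp_real (hv x y) (f.2 x y))
  refine ⟨g, ?_, ?_⟩
  · rw [hb_dist, BoundedContinuousFunction.dist_le hη]
    intro x
    rw [hg, Real.dist_eq]
    exact clamp_real_near hη
  · intro x hx
    rw [hg]
    exact clamp_real_eq hx

/-- Local-to-global: if good functions are dense in some ball, then they are dense. -/
lemma dense_good (hF : IsCompact F) (h0 : 0 < α) (d : ℝ≥0) (f0 : HolderBall p α F) (ε : ℝ)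
    (hε : 0 < ε)
    (hd : ball f0 ε ⊆ closure {f : HolderBall p α F | Good d (fun x => f.1 x) univ}) :
    Dense {f : HolderBall p α F | Good d (fun x => f.1 x) univ} := by
  have : CompactSpace ↥F := isCompact_iff_compactSpace.mp hF
  obtain ⟨r, hr0, hr⟩ : ∃ r : ℝ, 0 < r ∧ 2 * r ^ α ≤ ε / 2 := by
    refine ⟨(ε / 4) ^ α⁻¹, by positivity, ?_⟩
    rw [Real.rpow_inv_rpow (by positivity) h0.ne']
    linarith
  have hloc : ∀ x0 : ↥F, Dense {f : HolderBall p α F | Good d (fun x => f.1 x) (closedBall x0 r)} := by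
    intro x0
    rw [Metric.dense_iff]
    intro f δ hδ
    obtain ⟨f1, hf1, hf1'⟩ := clamp_exists hF h0 f0 (fun x => f.1 x - f.1 x0 + f0.1 x0)
      (fun x y => by simpa using f.2 x y) (η := ε / 2) (by positivity)
    have hmem : f1 ∈ closure {f : HolderBall p α F | Good d (fun x => f.1 x) univ} :=
      hd (by rw [mem_ball]; linarith)
    obtain ⟨g, hg, hgd⟩ := Metric.mem_closure_iff.1 hmem (δ / 2) (by positivity)
    obtain ⟨h, hh, hh'⟩ := clamp_exists hF h0 f (fun x => g.1 x + (f.1 x0 - f0.1 x0))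
      (fun x y => by simpa using g.2 x y) (η := δ / 2) (by positivity)
    refine ⟨h, by rw [mem_ball]; linarith, ?_⟩
    refine Good.congr_affine (f := fun x => g.1 x) hg (subset_univ _) 1 (f.1 x0 - f0.1 x0) one_ne_zero ?_
    intro x hx
    rw [one_mul]
    apply hh'
    have hxr : dist x x0 ^ α ≤ r ^ α := Real.rpow_le_rpow dist_nonneg hx h0.le
    have e1 := hf1' x (by
      have a1 := abs_le.1 (f.2 x x0)
      have a2 := abs_le.1 (f0.2 x x0)
      rw [abs_le]; constructor <;> linarith)
    have e2 : dist (f1.1 x) (g.1 x) ≤ dist f1 g := BoundedContinuousFunction.dist_coe_le_dist x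
    rw [Real.dist_eq, e1] at e2
    have e3 := abs_le.1 (e2.trans hgd.le)
    rw [abs_le]; constructor <;> linarith
  obtain ⟨T, -, hTf, hT⟩ := isCompact_univ.elim_finite_subcover_image (b := (univ : Set ↥F))
    (c := fun x => ball x r) (fun _ _ => isOpen_ball)
    (fun x _ => mem_biUnion (mem_univ x) (mem_ball_self hr0))
  have hD : Dense (⋂ x ∈ T, {f : HolderBall p α F | Good d (fun x => f.1 x) (closedBall x r)}) :=
    dense_biInter_of_Gδ (fun x _ => isGδ_good hF isClosed_closedBall d) hTf.countable
      (fun x _ => hloc x)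
  refine hD.mono ?_
  intro f hf
  simp only [mem_iInter, mem_ofPred_eq] at hf
  show Good d (fun x => f.1 x) univ
  unfold Good at *
  refine measure_mono_null ?_ ((measure_biUnion_null_iff hTf.countable).2 hf)
  intro y hy
  have hsub : (fun x => f.1 x) ⁻¹' {y} ∩ univ ⊆
      ⋃ x ∈ T, ((fun x => f.1 x) ⁻¹' {y} ∩ closedBall x r) := by
    rintro z ⟨hz, -⟩
    obtain ⟨x, hxT, hzx⟩ := mem_iUnion₂.1 (hT (mem_univ z))
    exact mem_iUnion₂.2 ⟨x, hxT, hz, ball_subset_closedBall hzx⟩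
  have h1 := lt_of_lt_of_le hy (dimH_mono hsub)
  rw [dimH_bUnion hTf.countable] at h1
  simp only [lt_iSup_iff] at h1
  obtain ⟨x, hx, h2⟩ := h1
  exact mem_iUnion₂.2 ⟨x, hx, h2⟩

end Space

lemma rpow_conc {s t β : ℝ} (hs : 0 ≤ s) (ht : 0 ≤ t) (h0 : 0 < β) (h1 : β ≤ 1) :
    s * (s + t) ^ β ≤ (s + t) * s ^ β := by
  rcases hs.eq_or_lt with rfl | hs'
  · simp [Real.zero_rpow h0.ne']
  · have hu : 0 < s + t := by linarith
    have e1 : s ^ β * s ^ (1 - β) = s := by rw [← Real.rpow_add hs']; simp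
    have e2 : (s + t) ^ β * (s + t) ^ (1 - β) = s + t := by rw [← Real.rpow_add hu]; simp
    have h3 : s ^ (1 - β) ≤ (s + t) ^ (1 - β) :=
      Real.rpow_le_rpow hs (by linarith) (by linarith)
    calc s * (s + t) ^ β = (s ^ β * (s + t) ^ β) * s ^ (1 - β) := by
          nth_rewrite 1 [← e1]; ring
      _ ≤ (s ^ β * (s + t) ^ β) * (s + t) ^ (1 - β) := by gcongr
      _ = (s + t) * s ^ β := by nth_rewrite 3 [← e2]; ring

def psi (α α' c t : ℝ) : ℝ := min (t ^ α) (c * t ^ α')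

lemma psi_nonneg {α α' c t : ℝ} (hc : 0 ≤ c) (ht : 0 ≤ t) : 0 ≤ psi α α' c t :=
  le_min (by positivity) (by positivity)

lemma psi_mono {α α' c s t : ℝ} (h0 : 0 < α) (h0' : 0 < α') (hc : 0 ≤ c) (hs : 0 ≤ s)
    (hst : s ≤ t) : psi α α' c s ≤ psi α α' c t := by
  unfold psi
  exact min_le_min (Real.rpow_le_rpow hs hst h0.le)
    (mul_le_mul_of_nonneg_left (Real.rpow_le_rpow hs hst h0'.le) hc)

lemma psi_conc {α α' c s t : ℝ} (h0 : 0 < α) (h0' : 0 < α') (h1 : α ≤ 1) (h1' : α' ≤ 1)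
    (hc : 0 ≤ c) (hs : 0 ≤ s) (ht : 0 ≤ t) :
    s * psi α α' c (s + t) ≤ (s + t) * psi α α' c s := by
  have a1 := rpow_conc hs ht h0 h1
  have a2 := mul_le_mul_of_nonneg_left (rpow_conc hs ht h0' h1') hc
  have b1 : psi α α' c (s + t) ≤ (s + t) ^ α := min_le_left _ _
  have b2 : psi α α' c (s + t) ≤ c * (s + t) ^ α' := min_le_right _ _
  have c1 := mul_le_mul_of_nonneg_left b1 hs
  have c2 := mul_le_mul_of_nonneg_left b2 hs
  rcases min_choice (s ^ α) (c * s ^ α') with h | h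
  · have : psi α α' c s = s ^ α := h
    rw [this]; linarith
  · have : psi α α' c s = c * s ^ α' := h
    rw [this]; linarith

lemma psi_subadd {α α' c s t : ℝ} (h0 : 0 < α) (h0' : 0 < α') (h1 : α ≤ 1) (h1' : α' ≤ 1)
    (hc : 0 ≤ c) (hs : 0 ≤ s) (ht : 0 ≤ t) :
    psi α α' c (s + t) ≤ psi α α' c s + psi α α' c t := by
  have a1 := psi_conc h0 h0' h1 h1' hc hs ht
  have a2 := psi_conc h0 h0' h1 h1' hc ht hs
  rw [add_comm t s] at a2
  rcases (add_nonneg hs ht).eq_or_lt with h | h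
  · have e1 : s = 0 := by linarith
    have e2 : t = 0 := by linarith
    subst e1 e2
    simp [psi, Real.zero_rpow h0.ne', Real.zero_rpow h0'.ne']
  · refine le_of_mul_le_mul_left ?_ h
    linarith

lemma approx_holder {p : ℕ} {α α' : ℝ} {F : Set (Euc p)} (h0 : 0 < α) (h1 : α < α')
    (h2 : α' ≤ 1) (f : HolderBall p α F) {δ : ℝ} (hδ : 0 < δ) :
    ∃ (g : ↥F → ℝ) (c t0 : ℝ), 0 < c ∧ 0 < t0 ∧ (∀ t, 0 ≤ t → t ≤ t0 → c * t ^ α' ≤ t ^ α) ∧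
      (∀ x y, |g x - g y| ≤ dist x y ^ α) ∧ (∀ x y, |g x - g y| ≤ c * dist x y ^ α') ∧
      ∀ x, |g x - f.1 x| ≤ δ := by
  have h0' : 0 < α' := h0.trans h1
  set t0 : ℝ := δ ^ α⁻¹ with ht0
  have ht0p : 0 < t0 := by positivity
  have ht0a : t0 ^ α = δ := Real.rpow_inv_rpow hδ.le h0.ne'
  set c : ℝ := (t0 ^ (α' - α))⁻¹ with hc
  have hcp : 0 < c := by positivity
  have hsplit : ∀ t : ℝ, 0 ≤ t → t ^ α' = t ^ (α' - α) * t ^ α := fun t ht => by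
    rw [← Real.rpow_add_of_nonneg ht (by linarith) h0.le]; simp
  have hsmall : ∀ t, 0 ≤ t → t ≤ t0 → c * t ^ α' ≤ t ^ α := by
    intro t ht htt
    rw [hsplit t ht, ← mul_assoc]
    have : c * t ^ (α' - α) ≤ 1 := by
      rw [hc, inv_mul_le_iff₀ (by positivity), mul_one]
      exact Real.rpow_le_rpow ht htt (by linarith)
    exact mul_le_of_le_one_left (by positivity) this
  have hbig : ∀ t, t0 ≤ t → t ^ α ≤ c * t ^ α' := by
    intro t htt
    have ht : 0 ≤ t := ht0p.le.trans htt
    rw [hsplit t ht, ← mul_assoc]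
    have : 1 ≤ c * t ^ (α' - α) := by
      rw [hc, le_inv_mul_iff₀ (by positivity), mul_one]
      exact Real.rpow_le_rpow ht0p.le htt (by linarith)
    exact le_mul_of_one_le_left (by positivity) this
  have hpsi : ∀ t, 0 ≤ t → t ^ α - psi α α' c t ≤ δ := by
    intro t ht
    rcases le_total t t0 with h | h
    · have a := psi_nonneg (α := α) (α' := α') hcp.le ht
      have b := Real.rpow_le_rpow ht h h0.le
      linarith
    · have : psi α α' c t = t ^ α := min_eq_left (hbig t h)
      linarith
  have hbdd : ∀ x : ↥F, BddBelow (range fun y : ↥F => f.1 y + psi α α' c (dist x y)) := by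
    intro x
    refine ⟨-‖f.1‖, ?_⟩
    rintro _ ⟨y, rfl⟩
    have a := psi_nonneg (α := α) (α' := α') hcp.le (dist_nonneg (x := x) (y := y))
    have b := (abs_le.1 (f.1.norm_coe_le_norm y)).1
    show -‖f.1‖ ≤ f.1 y + psi α α' c (dist x y)
    linarith
  set g : ↥F → ℝ := fun x => ⨅ y : ↥F, (f.1 y + psi α α' c (dist x y)) with hg
  have hmod : ∀ x y, g x - g y ≤ psi α α' c (dist x y) := by
    intro x y
    have : Nonempty ↥F := ⟨x⟩
    have : g x - psi α α' c (dist x y) ≤ g y := by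
      refine le_ciInf fun z => ?_
      have a : g x ≤ f.1 z + psi α α' c (dist x z) := ciInf_le (hbdd x) z
      have b := psi_mono (α := α) (α' := α') h0 h0' hcp.le dist_nonneg (dist_triangle x y z)
      have d := psi_subadd (α := α) (α' := α') h0 h0' (by linarith) h2 hcp.le
        (dist_nonneg (x := x) (y := y)) (dist_nonneg (x := y) (y := z))
      linarith
    linarith
  have hmod2 : ∀ x y, |g x - g y| ≤ psi α α' c (dist x y) := by
    intro x y
    have a := hmod x y
    have b := hmod y x
    rw [dist_comm] at b
    rw [abs_le]; constructor <;> linarith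
  refine ⟨g, c, t0, hcp, ht0p, hsmall, fun x y => (hmod2 x y).trans (min_le_left _ _),
    fun x y => (hmod2 x y).trans (min_le_right _ _), fun x => ?_⟩
  have : Nonempty ↥F := ⟨x⟩
  have a : g x ≤ f.1 x + psi α α' c (dist x x) := ciInf_le (hbdd x) x
  have a' : psi α α' c (dist x x) = 0 := by
    simp [psi, Real.zero_rpow h0.ne', Real.zero_rpow h0'.ne']
  have b : f.1 x - δ ≤ g x := by
    refine le_ciInf fun y => ?_
    have a := (abs_le.1 (f.2 x y)).2
    have b := hpsi (dist x y) dist_nonneg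
    linarith
  rw [abs_le]; constructor <;> linarith

lemma dense_transfer {p : ℕ} {α α' : ℝ} {F : Set (Euc p)} (hF : IsCompact F) (h0 : 0 < α)
    (h1 : α < α') (h2 : α' ≤ 1) (d : ℝ≥0)
    (hd : Dense {f : HolderBall p α' F | Good d (fun x => f.1 x) univ}) :
    Dense {f : HolderBall p α F | Good d (fun x => f.1 x) univ} := by
  rw [Metric.dense_iff]
  intro f δ hδ
  obtain ⟨g, c, t0, hc, ht0, hsmall, hg1, hg2, hg3⟩ :=
    approx_holder h0 h1 h2 f (δ := δ / 4) (by positivity)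
  set B : ℝ := ‖f.1‖ + δ with hB
  have hBp : 0 < B := by positivity
  have hgB : ∀ x, |g x| ≤ B := by
    intro x
    have a := abs_le.1 (hg3 x)
    have b := abs_le.1 (f.1.norm_coe_le_norm x)
    rw [abs_le]; constructor <;> linarith [a.1, a.2, b.1, b.2]
  obtain ⟨e, he0, he1, heB⟩ : ∃ e : ℝ, 0 < e ∧ e ≤ 1 ∧ e * B ≤ δ / 4 := by
    refine ⟨min 1 (δ / 4 / B), by positivity, min_le_left _ _, ?_⟩
    rw [← le_div_iff₀ hBp]
    exact min_le_right _ _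
  obtain ⟨u, hu⟩ := hb_mk hF (h0.trans h1) (fun x => (1 - e) * g x / c) (by
    intro x y
    have : (1 - e) * g x / c - (1 - e) * g y / c = (1 - e) * ((g x - g y) / c) := by ring
    rw [this, abs_mul, abs_div, abs_of_pos hc, abs_of_nonneg (by linarith : 0 ≤ 1 - e)]
    have h3 : |g x - g y| / c ≤ dist x y ^ α' := by
      rw [div_le_iff₀' hc]; exact hg2 x y
    exact (mul_le_of_le_one_left (by positivity) (by linarith)).trans h3)
  set η : ℝ := min (δ / 4) (e * t0 ^ α / 2) with hη
  have hηp : 0 < η := by positivity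
  have hη1 : η ≤ δ / 4 := min_le_left _ _
  have hη2 : η ≤ e * t0 ^ α / 2 := min_le_right _ _
  obtain ⟨h, hh1, hh2⟩ := Metric.dense_iff.1 hd u (η / c) (by positivity)
  have hnear : ∀ x, |c * h.1 x - (1 - e) * g x| ≤ η := by
    intro x
    have a : dist (h.1 x) (u.1 x) ≤ dist h u := BoundedContinuousFunction.dist_coe_le_dist x
    have b := a.trans (le_of_lt hh1)
    rw [Real.dist_eq, hu, le_div_iff₀' hc] at b
    have e1 : c * h.1 x - (1 - e) * g x = c * (h.1 x - (1 - e) * g x / c) := by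
      field_simp
    rw [e1, abs_mul, abs_of_pos hc]
    exact b
  obtain ⟨k, hk⟩ := hb_mk (α := α) hF h0 (fun x => c * h.1 x) (by
    intro x y
    rcases le_total (dist x y) t0 with hD | hD
    · have e1 : c * h.1 x - c * h.1 y = c * (h.1 x - h.1 y) := by ring
      rw [e1, abs_mul, abs_of_pos hc]
      exact (mul_le_mul_of_nonneg_left (h.2 x y) hc.le).trans (hsmall _ dist_nonneg hD)
    · have a1 := abs_le.1 (hnear x)
      have a2 := abs_le.1 (hnear y)
      have a3 := abs_le.1 (hg1 x y)
      have a4 : e * t0 ^ α ≤ e * dist x y ^ α :=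
        mul_le_mul_of_nonneg_left (Real.rpow_le_rpow ht0.le hD h0.le) he0.le
      have a5 := mul_le_mul_of_nonneg_left a3.1 (by linarith : 0 ≤ 1 - e)
      have a6 := mul_le_mul_of_nonneg_left a3.2 (by linarith : 0 ≤ 1 - e)
      rw [abs_le]; constructor <;> linarith [a1.1, a1.2, a2.1, a2.2])
  refine ⟨k, ?_, ?_⟩
  · rw [mem_ball, hb_dist]
    refine lt_of_le_of_lt ((BoundedContinuousFunction.dist_le (C := 3 * δ / 4) (by positivity)).2
      fun x => ?_) (by linarith)
    rw [hk, Real.dist_eq]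
    have a1 := abs_le.1 (hnear x)
    have a2 := abs_le.1 (hg3 x)
    have a3 : |e * g x| ≤ δ / 4 := by
      rw [abs_mul, abs_of_pos he0]
      exact (mul_le_mul_of_nonneg_left (hgB x) he0.le).trans heB
    have a4 := abs_le.1 a3
    rw [abs_le]; constructor <;> linarith [a1.1, a1.2, a2.1, a2.2, a4.1, a4.2]
  · refine Good.congr_affine (f := fun x => h.1 x) hh2 subset_rfl c 0 hc.ne' ?_
    intro x _
    rw [hk, add_zero]

section Dstar

variable {p : ℕ} {F : Set (Euc p)}

lemma dimH_le_p (S : Set ↥F) : dimH S ≤ p := by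
  rw [← (isometry_subtype_coe (s := F)).dimH_image S]
  refine (dimH_mono (subset_univ _)).trans ?_
  rw [Real.dimH_univ_eq_finrank]
  simp

lemma dstar_bdd (f : ↥F → ℝ) (A : Set ↥F) :
    ∀ d ∈ {d : ℝ | 0 < volume {r : ℝ | ENNReal.ofReal d ≤ dimH (f ⁻¹' {r} ∩ A)}}, d ≤ p := by
  intro d hd
  obtain ⟨r, hr⟩ := nonempty_of_measure_ne_zero (ne_of_gt hd)
  have h1 : ENNReal.ofReal d ≤ ENNReal.ofReal p := by
    rw [ENNReal.ofReal_natCast]; exact le_trans hr (dimH_le_p _)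
  exact (ENNReal.ofReal_le_ofReal_iff (by positivity)).1 h1

lemma dstar_zero_mem (f : ↥F → ℝ) (A : Set ↥F) :
    (0 : ℝ) ∈ {d : ℝ | 0 < volume {r : ℝ | ENNReal.ofReal d ≤ dimH (f ⁻¹' {r} ∩ A)}} := by
  simp

lemma dstar_nonneg (f : ↥F → ℝ) (A : Set ↥F) : 0 ≤ DstarOn f A :=
  le_csSup ⟨p, dstar_bdd f A⟩ (dstar_zero_mem f A)

lemma dstar_le_p (f : ↥F → ℝ) (A : Set ↥F) : DstarOn f A ≤ p :=
  csSup_le ⟨0, dstar_zero_mem f A⟩ (dstar_bdd f A)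

lemma dstar_le_of_good {d : ℝ} (hd : 0 < d) (f : ↥F → ℝ) (A : Set ↥F)
    (h : Good d.toNNReal f A) : DstarOn f A ≤ d := by
  refine csSup_le ⟨0, dstar_zero_mem f A⟩ ?_
  intro e he
  by_contra! hlt
  refine (ne_of_gt he) (measure_mono_null ?_ h)
  intro r hr
  rw [mem_ofPred_eq] at hr ⊢
  refine lt_of_lt_of_le ?_ hr
  exact (ENNReal.ofReal_lt_ofReal_iff (hd.trans hlt)).2 hlt

lemma le_dstar_of_not_good {d : ℝ} (f : ↥F → ℝ) (A : Set ↥F)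
    (h : ¬ Good d.toNNReal f A) : d ≤ DstarOn f A := by
  refine le_csSup ⟨p, dstar_bdd f A⟩ ?_
  refine lt_of_lt_of_le (pos_iff_ne_zero.2 h) (measure_mono ?_)
  intro r hr
  rw [mem_ofPred_eq] at hr ⊢
  exact le_of_lt hr

end Dstar

theorem stmt13 (p : ℕ) (F : Set (Euc p)) (hF : IsCompact F)
    (hdiam : Metric.diam F ≤ 1)
    (α α' : ℝ) (h0 : 0 < α) (h1 : α ≤ α') (h2 : α' ≤ 1) :
    DstarAlpha p α F ≤ DstarAlpha p α' F := by
  rcases h1.eq_or_lt with rfl | h1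
  · exact le_rfl
  have h0' := h0.trans h1
  have hne : ∀ β : ℝ, 0 < β → Nonempty (HolderBall p β F) := fun β hβ => by
    obtain ⟨g, -⟩ := hb_mk (p := p) hF hβ (fun _ => 0) (fun x y => by simp; positivity)
    exact ⟨g⟩
  have hneα := hne α h0
  have hneα' := hne α' h0'
  have hbb : ∀ (β : ℝ) (G : Set (HolderBall p β F)), BddBelow ((fun f : HolderBall p β F =>
      DstarOn (fun x : ↥F => f.1 x) Set.univ) '' G) := by
    intro β G
    refine ⟨0, ?_⟩
    rintro _ ⟨f, -, rfl⟩
    exact dstar_nonneg _ _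
  have hba : BddAbove {v : ℝ | ∃ G : Set (HolderBall p α' F), Dense G ∧ IsGδ G ∧
      v = sInf ((fun f : HolderBall p α' F =>
        DstarOn (fun x : ↥F => f.1 x) Set.univ) '' G)} := by
    refine ⟨p, ?_⟩
    rintro v ⟨G, hG1, -, rfl⟩
    obtain ⟨f, hf⟩ := hG1.nonempty
    exact (csInf_le (hbb α' G) ⟨f, hf, rfl⟩).trans (dstar_le_p _ _)
  have hnonneg : 0 ≤ DstarAlpha p α' F := by
    refine le_csSup_of_le hba ⟨univ, dense_univ, .univ, rfl⟩ ?_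
    refine Real.sInf_nonneg ?_
    rintro _ ⟨f, -, rfl⟩
    exact dstar_nonneg _ _
  refine csSup_le ⟨_, univ, dense_univ, .univ, rfl⟩ ?_
  rintro v ⟨G, hG1, hG2, rfl⟩
  refine le_of_forall_gt_imp_ge_of_dense fun d hd => ?_
  have hd0 : 0 < d := hnonneg.trans_lt hd
  set S : Set (HolderBall p α' F) := {f | Good d.toNNReal (fun x => f.1 x) univ} with hS
  have hint : (interior (closure S)).Nonempty := by
    by_contra hc
    rw [Set.not_nonempty_iff_eq_empty, interior_eq_empty_iff_dense_compl] at hc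
    refine absurd hd (not_lt.2 ?_)
    refine le_csSup_of_le hba ⟨(closure S)ᶜ, hc, isClosed_closure.isOpen_compl.isGδ, rfl⟩ ?_
    refine le_csInf (hc.nonempty.image _) ?_
    rintro _ ⟨f, hf, rfl⟩
    exact le_dstar_of_not_good _ _ fun hgood => hf (subset_closure hgood)
  obtain ⟨f0, hf0⟩ := hint
  obtain ⟨ε, hε, hball⟩ := Metric.isOpen_iff.1 isOpen_interior f0 hf0
  have hdense := dense_good hF h0' d.toNNReal f0 ε hε (hball.trans interior_subset)
  have hdense2 := dense_transfer hF h0 h1 h2 d.toNNReal hdense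
  obtain ⟨f, hf1, hf2⟩ := (hG1.inter_of_Gδ hG2 (isGδ_good hF isClosed_univ _) hdense2).nonempty
  exact (csInf_le (hbb α G) ⟨f, hf1, rfl⟩).trans (dstar_le_of_good hd0 _ _ hf2)
end
end
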